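/- arXiv:math/0504153 — 3 statements merged into one kernel-verified Lean document; each statement's English description precedes it below -/
import Mathlib

section
/- Let F(t) = Σ_{n≥0} o_{1,1}^{(1,0)}(n) t^n ∈ ℚ[[t]], where o_{1,1}^{(1,0)}(n) is the number of osculating (1,1)-stars of length n with j_{n,2}−j_{n,1}=2 and j_{n,3}=j_{n,2}, and let B(t) = Σ_{n≥1} b_n t^n be the generating function of the Baxter numbers. Then t(1+t)·F(t) = (1−t)·B(t) − t. -/
/-- A single directed walk of length `n`: consecutive ordinates differ by `±1`. -/
def IsSteps {n : ℕ} (w : Fin (n + 1) → ℤ) : Prop :=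
  ∀ m : Fin n, w m.succ - w m.castSucc = 1 ∨ w m.succ - w m.castSucc = -1

/-- A configuration of three walkers is non-crossing if the ordinates stay ordered. -/
def NonCrossing {n : ℕ} (p : Fin 3 → Fin (n + 1) → ℤ) : Prop :=
  ∀ m, p 0 m ≤ p 1 m ∧ p 1 m ≤ p 2 m

/-- An osculating configuration of three walkers: three `±1`-step walks, non-crossing,
and whenever two neighbouring walkers meet at time `m < n` they separate at time `m+1`. -/
def Osculating {n : ℕ} (p : Fin 3 → Fin (n + 1) → ℤ) : Prop :=
  (∀ k, IsSteps (p k)) ∧ NonCrossing p ∧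
    ∀ m : Fin n,
      (p 0 m.castSucc = p 1 m.castSucc → p 0 m.succ < p 1 m.succ) ∧
      (p 1 m.castSucc = p 2 m.castSucc → p 1 m.succ < p 2 m.succ)

/-- A vicious (non-intersecting) configuration of three walkers. -/
def Vicious {n : ℕ} (p : Fin 3 → Fin (n + 1) → ℤ) : Prop :=
  (∀ k, IsSteps (p k)) ∧ ∀ m, p 0 m < p 1 m ∧ p 1 m < p 2 m

/-- An `(i,j)`-star starts at ordinates `0`, `2i`, `2(i+j)`. -/
def Starts {n : ℕ} (i j : ℕ) (p : Fin 3 → Fin (n + 1) → ℤ) : Prop :=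
  p 0 0 = 0 ∧ p 1 0 = 2 * (i : ℤ) ∧ p 2 0 = 2 * ((i : ℤ) + (j : ℤ))

/-- The `k`-th Baxter number `b_k = (2/(k(k+1)^2)) Σ_{r=0}^{k-1} C(k+1,r)C(k+1,r+1)C(k+1,r+2)`. -/
noncomputable def baxter (k : ℕ) : ℚ :=
  2 / ((k : ℚ) * ((k : ℚ) + 1) ^ 2) *
    ∑ r ∈ Finset.range k,
      ((k + 1).choose r * (k + 1).choose (r + 1) * (k + 1).choose (r + 2) : ℚ)

/-- The generating function `B(t) = Σ_{n ≥ 1} b_n t^n` of the Baxter numbers. -/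
noncomputable def baxterGF : PowerSeries ℚ :=
  PowerSeries.mk fun n => if n = 0 then 0 else baxter n

/-- `F(t) = Σ_n o_{1,1}^{(1,0)}(n) t^n`. -/
noncomputable def F1110 : PowerSeries ℚ :=
  PowerSeries.mk fun n =>
    (Nat.card {p : Fin 3 → Fin (n + 1) → ℤ // Osculating p ∧ Starts 1 1 p ∧
      p 1 (Fin.last n) - p 0 (Fin.last n) = 2 ∧
      p 2 (Fin.last n) = p 1 (Fin.last n)} : ℚ)

/-- The binomial coefficient `C(n, z)` with an integer lower index, zero for `z < 0`. -/
def intChoose : ℕ → ℤ → ℚ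
  | 0, z => if z = 0 then 1 else 0
  | n + 1, z => intChoose n z + intChoose n (z - 1)

theorem intChoose_of_neg (n : ℕ) : ∀ z : ℤ, z < 0 → intChoose n z = 0 := by
  induction n with
  | zero => intro z hz; simp [intChoose, hz.ne]
  | succ n ih => intro z hz; simp [intChoose, ih z hz, ih (z - 1) (by omega)]

theorem intChoose_natCast (n : ℕ) : ∀ m : ℕ, intChoose n m = n.choose m := by
  induction n with
  | zero => intro m; cases m <;> simp [intChoose]; omega
  | succ n ih =>
    intro m
    cases m with
    | zero => simpa [intChoose, intChoose_of_neg] using ih 0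
    | succ m =>
      have h := ih (m + 1)
      push_cast at h
      simp [intChoose, h, ih m, Nat.choose_succ_succ, add_comm]

theorem intChoose_of_lt {n : ℕ} {z : ℤ} (h : n < z) : intChoose n z = 0 := by
  lift z to ℕ using by omega
  rw [intChoose_natCast, Nat.choose_eq_zero_of_lt (by omega), Nat.cast_zero]

/-- The determinant counting vicious triples of paths of length `n`, in Lindström–Gessel–Viennot
form: the entries of row `i` are `C(n, zᵢ)`, `C(n, zᵢ + 1)`, `C(n, zᵢ + 2)`. -/
def pathDet (n : ℕ) (x y z : ℤ) : ℚ :=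
  intChoose n x * (intChoose n (y + 1) * intChoose n (z + 2)
      - intChoose n (y + 2) * intChoose n (z + 1))
    - intChoose n (x + 1) * (intChoose n y * intChoose n (z + 2)
      - intChoose n (y + 2) * intChoose n z)
    + intChoose n (x + 2) * (intChoose n y * intChoose n (z + 1)
      - intChoose n (y + 1) * intChoose n z)

theorem pathDet_succ (n : ℕ) (x y z : ℤ) :
    pathDet (n + 1) x y z =
      pathDet n x y z + pathDet n x y (z - 1) + pathDet n x (y - 1) z
        + pathDet n x (y - 1) (z - 1) + pathDet n (x - 1) y z + pathDet n (x - 1) y (z - 1)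
        + pathDet n (x - 1) (y - 1) z + pathDet n (x - 1) (y - 1) (z - 1) := by
  have h1 : ∀ w : ℤ, w + 1 - 1 = w - 1 + 1 := fun w => by ring
  have h2 : ∀ w : ℤ, w + 2 - 1 = w - 1 + 2 := fun w => by ring
  simp only [pathDet, intChoose, h1, h2]
  ring

theorem pathDet_self_left (n : ℕ) (x z : ℤ) : pathDet n x x z = 0 := by
  unfold pathDet; ring

theorem pathDet_self_right (n : ℕ) (x y : ℤ) : pathDet n x y y = 0 := by
  unfold pathDet; ring

theorem succ_mul_intChoose_succ (n : ℕ) :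
    ∀ z : ℤ, (z + 1 : ℚ) * intChoose n (z + 1) = (n - z) * intChoose n z := by
  induction n with
  | zero =>
    intro z
    simp only [intChoose]
    split_ifs with h1 h2 h2
    · omega
    · simp [show z = -1 by omega]
    · simp [h2]
    · simp
  | succ n ih =>
    intro z
    have h1 := ih z
    have h2 := ih (z - 1)
    push_cast at h2
    simp only [sub_add_cancel] at h2
    simp only [intChoose, add_sub_cancel_right]
    push_cast
    linear_combination h1 + h2

theorem pathDet_eq_zero {n : ℕ} {x : ℤ} (h : x < -2 ∨ n < x) (y z : ℤ) :
    pathDet n x y z = 0 := by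
  have hx : intChoose n x = 0 ∧ intChoose n (x + 1) = 0 ∧ intChoose n (x + 2) = 0 := by
    rcases h with h | h
    · exact ⟨intChoose_of_neg _ _ (by omega), intChoose_of_neg _ _ (by omega),
        intChoose_of_neg _ _ (by omega)⟩
    · exact ⟨intChoose_of_lt h, intChoose_of_lt (by omega), intChoose_of_lt (by omega)⟩
  simp [pathDet, hx]

theorem pathDet_eq_zero_of_lt {n : ℕ} {z : ℤ} (h : z < -2) (x y : ℤ) :
    pathDet n x y z = 0 := by
  have h0 : intChoose n z = 0 := intChoose_of_neg _ _ (by omega)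
  have h1 : intChoose n (z + 1) = 0 := intChoose_of_neg _ _ (by omega)
  have h2 : intChoose n (z + 2) = 0 := intChoose_of_neg _ _ (by omega)
  simp [pathDet, h0, h1, h2]

theorem support_pathDet_subset (n : ℕ) (c : ℤ) (f g : ℤ → ℤ) :
    (Function.support fun a => pathDet n (a - c) (f a) (g a)) ⊆ Set.Icc (c - 2) (n + c) := by
  intro a ha
  by_contra hc
  rw [Set.mem_Icc] at hc
  exact ha (pathDet_eq_zero (by omega) _ _)

theorem finite_support_pathDet (n : ℕ) (c : ℤ) (f g : ℤ → ℤ) :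
    (Function.support fun a => pathDet n (a - c) (f a) (g a)).Finite :=
  (Set.finite_Icc _ _).subset (support_pathDet_subset n c f g)

/-- The number of vicious configurations of length `n` from half-gaps `(k, l)` to `(1, 1)`. -/
noncomputable def viciousSum (n : ℕ) (k l : ℤ) : ℚ :=
  ∑ᶠ a : ℤ, pathDet n a (a - k) (a - k - l)

theorem finsum_pathDet (n : ℕ) (c k l : ℤ) {f g : ℤ → ℤ} (hf : ∀ a, f a = a - c - k)
    (hg : ∀ a, g a = a - c - k - l) :
    ∑ᶠ a : ℤ, pathDet n (a - c) (f a) (g a) = viciousSum n k l := by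
  simp only [hf, hg]
  exact finsum_comp_equiv (Equiv.subRight c) (f := fun a => pathDet n a (a - k) (a - k - l))

theorem viciousSum_succ (n : ℕ) (k l : ℤ) :
    viciousSum (n + 1) k l =
      2 * viciousSum n k l + viciousSum n k (l + 1) + viciousSum n (k + 1) (l - 1)
        + viciousSum n (k + 1) l + viciousSum n (k - 1) l + viciousSum n (k - 1) (l + 1)
        + viciousSum n k (l - 1) := by
  have fin (c : ℤ) (f g : ℤ → ℤ) := finite_support_pathDet n c f g
  have fin0 (f g : ℤ → ℤ) : (Function.support fun a => pathDet n a (f a) (g a)).Finite := by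
    simpa using fin 0 f g
  have sum0 (k l : ℤ) {f g : ℤ → ℤ} (hf : ∀ a, f a = a - k) (hg : ∀ a, g a = a - k - l) :
      ∑ᶠ a : ℤ, pathDet n a (f a) (g a) = viciousSum n k l := by
    simpa using finsum_pathDet n 0 k l (f := f) (g := g) (by simpa using hf) (by simpa using hg)
  have key : viciousSum (n + 1) k l =
      viciousSum n k l + viciousSum n k (l + 1) + viciousSum n (k + 1) (l - 1)
        + viciousSum n (k + 1) l + viciousSum n (k - 1) l + viciousSum n (k - 1) (l + 1)
        + viciousSum n k (l - 1) + viciousSum n k l := by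
    rw [viciousSum, finsum_congr fun a => pathDet_succ n a (a - k) (a - k - l)]
    have union {F G : ℤ → ℚ} (hF : F.support.Finite) (hG : G.support.Finite) :
        (Function.support fun a => F a + G a).Finite :=
      (hF.union hG).subset (Function.support_add F G)
    have f1 := fin0 (fun a => a - k) (fun a => a - k - l)
    have f2 := union f1 (fin0 (fun a => a - k) (fun a => a - k - l - 1))
    have f3 := union f2 (fin0 (fun a => a - k - 1) (fun a => a - k - l))
    have f4 := union f3 (fin0 (fun a => a - k - 1) (fun a => a - k - l - 1))
    have f5 := union f4 (fin 1 (fun a => a - k) (fun a => a - k - l))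
    have f6 := union f5 (fin 1 (fun a => a - k) (fun a => a - k - l - 1))
    have f7 := union f6 (fin 1 (fun a => a - k - 1) (fun a => a - k - l))
    rw [finsum_add_distrib f7 (fin 1 (fun a => a - k - 1) (fun a => a - k - l - 1)),
      finsum_add_distrib f6 (fin 1 (fun a => a - k - 1) (fun a => a - k - l)),
      finsum_add_distrib f5 (fin 1 (fun a => a - k) (fun a => a - k - l - 1)),
      finsum_add_distrib f4 (fin 1 (fun a => a - k) (fun a => a - k - l)),
      finsum_add_distrib f3 (fin0 (fun a => a - k - 1) (fun a => a - k - l - 1)),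
      finsum_add_distrib f2 (fin0 (fun a => a - k - 1) (fun a => a - k - l)),
      finsum_add_distrib f1 (fin0 (fun a => a - k) (fun a => a - k - l - 1)),
      sum0 k l (fun a => by ring) (fun a => by ring),
      sum0 k (l + 1) (fun a => by ring) (fun a => by ring),
      sum0 (k + 1) (l - 1) (fun a => by ring) (fun a => by ring),
      sum0 (k + 1) l (fun a => by ring) (fun a => by ring),
      finsum_pathDet n 1 (k - 1) l (fun a => by ring) (fun a => by ring),
      finsum_pathDet n 1 (k - 1) (l + 1) (fun a => by ring) (fun a => by ring),
      finsum_pathDet n 1 k (l - 1) (fun a => by ring) (fun a => by ring),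
      finsum_pathDet n 1 k l (fun a => by ring) (fun a => by ring)]
  rw [key]; ring

theorem viciousSum_zero_left (n : ℕ) (l : ℤ) : viciousSum n 0 l = 0 := by
  simp [viciousSum, pathDet_self_left]

theorem viciousSum_zero_right (n : ℕ) (k : ℤ) : viciousSum n k 0 = 0 := by
  simp [viciousSum, pathDet_self_right]

theorem viciousSum_zero {k l : ℤ} (hk : 1 ≤ k) (hl : 1 ≤ l) :
    viciousSum 0 k l = if k = 1 ∧ l = 1 then 1 else 0 := by
  have hz : ∀ a : ℤ, a ≠ 0 → pathDet 0 a (a - k) (a - k - l) = 0 := by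
    intro a ha
    rcases lt_or_gt_of_ne ha with h | h
    · exact pathDet_eq_zero_of_lt (by omega) _ _
    · exact pathDet_eq_zero (Or.inr (by exact_mod_cast h)) _ _
  rw [viciousSum, finsum_eq_single _ 0 hz]
  split_ifs with h
  · simp [h, pathDet, intChoose]
  · exact pathDet_eq_zero_of_lt (by omega) _ _

/-- The number of osculating configurations of length `n` from half-gaps `(k, l)` to `(1, 0)`. -/
def oscCount : ℕ → ℤ → ℤ → ℕ
  | 0, k, l => if k = 1 ∧ l = 0 then 1 else 0
  | n + 1, k, l =>
    if 1 ≤ k ∧ 1 ≤ l then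
      2 * oscCount n k l + oscCount n k (l + 1) + oscCount n (k + 1) (l - 1)
        + oscCount n (k + 1) l + oscCount n (k - 1) l + oscCount n (k - 1) (l + 1)
        + oscCount n k (l - 1)
    else if k = 0 ∧ 1 ≤ l then oscCount n 1 (l - 1) + oscCount n 1 l
    else if 1 ≤ k ∧ l = 0 then oscCount n k 1 + oscCount n (k - 1) 1
    else 0

theorem oscCount_succ_of_pos (n : ℕ) {k l : ℤ} (hk : 1 ≤ k) (hl : 1 ≤ l) :
    oscCount (n + 1) k l =
      2 * oscCount n k l + oscCount n k (l + 1) + oscCount n (k + 1) (l - 1)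
        + oscCount n (k + 1) l + oscCount n (k - 1) l + oscCount n (k - 1) (l + 1)
        + oscCount n k (l - 1) := by
  rw [oscCount, if_pos ⟨hk, hl⟩]

theorem oscCount_succ_zero_left (n : ℕ) {l : ℤ} (hl : 1 ≤ l) :
    oscCount (n + 1) 0 l = oscCount n 1 (l - 1) + oscCount n 1 l := by
  simp [oscCount, hl]

theorem oscCount_succ_zero_right (n : ℕ) {k : ℤ} (hk : 1 ≤ k) :
    oscCount (n + 1) k 0 = oscCount n k 1 + oscCount n (k - 1) 1 := by
  simp [oscCount, hk]

theorem oscCount_succ_zero_zero (n : ℕ) : oscCount (n + 1) 0 0 = 0 := by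
  simp [oscCount]

theorem oscCount_add_add_eq_viciousSum (n : ℕ) : ∀ k l : ℤ, 1 ≤ k → 1 ≤ l →
    (oscCount n k l + oscCount n (k - 1) l + oscCount n k (l - 1) : ℚ) = viciousSum n k l := by
  induction n with
  | zero =>
    intro k l hk hl
    rw [viciousSum_zero hk hl]
    simp only [oscCount]
    split_ifs <;> first | omega | norm_num
  | succ n ih =>
    intro k l hk hl
    rw [viciousSum_succ, oscCount_succ_of_pos n hk hl, ← ih k l hk hl,
      ← ih k (l + 1) hk (by omega), ← ih (k + 1) l (by omega) hl]
    rcases hk.eq_or_lt with rfl | hk' <;> rcases hl.eq_or_lt with rfl | hl'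
    · norm_num [viciousSum_zero_left, viciousSum_zero_right, oscCount_succ_zero_left,
        oscCount_succ_zero_right]
      ring
    · rw [← ih (1 + 1) (l - 1) (by omega) (by omega), ← ih 1 (l - 1) (by omega) (by omega),
        oscCount_succ_of_pos n (k := 1) (l := l - 1) (by omega) (by omega)]
      norm_num [viciousSum_zero_left, oscCount_succ_zero_left, hl]
      ring
    · rw [← ih (k - 1) 1 (by omega) (by omega), ← ih (k - 1) (1 + 1) (by omega) (by omega),
        oscCount_succ_of_pos n (k := k - 1) (l := 1) (by omega) (by omega)]
      norm_num [viciousSum_zero_right, oscCount_succ_zero_right, hk]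
      ring
    · rw [← ih (k + 1) (l - 1) (by omega) (by omega), ← ih k (l - 1) (by omega) (by omega),
        ← ih (k - 1) l (by omega) (by omega), ← ih (k - 1) (l + 1) (by omega) (by omega),
        oscCount_succ_of_pos n (k := k - 1) (l := l) (by omega) (by omega),
        oscCount_succ_of_pos n (k := k) (l := l - 1) (by omega) (by omega)]
      norm_num
      ring

theorem oscCount_add_oscCount (n : ℕ) :
    (oscCount (n + 1) 1 1 + oscCount n 1 1 : ℚ) = viciousSum (n + 1) 1 1 - viciousSum n 1 1 := by
  rw [← oscCount_add_add_eq_viciousSum (n + 1) 1 1 le_rfl le_rfl,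
    ← oscCount_add_add_eq_viciousSum n 1 1 le_rfl le_rfl]
  norm_num [oscCount_succ_zero_left, oscCount_succ_zero_right]
  ring

theorem pathDet_consecutive (a m : ℕ) :
    pathDet (a + m) a (a - 1) (a - 1 - 1) =
      2 / (((a + m + 1 : ℕ) : ℚ) * (((a + m + 1 : ℕ) : ℚ) + 1) ^ 2) *
        ((a + m + 2).choose a * (a + m + 2).choose (a + 1) * (a + m + 2).choose (a + 2)) := by
  have h0 := succ_mul_intChoose_succ (a + m) a
  have h1 := succ_mul_intChoose_succ (a + m) (a + 1)
  have h2 := succ_mul_intChoose_succ (a + m) (a - 1)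
  have h3 := succ_mul_intChoose_succ (a + m) (a - 1 - 1)
  rw [sub_add_cancel] at h2 h3
  rw [add_assoc, one_add_one_eq_two] at h1
  push_cast at h0 h1 h2 h3
  have x1 : intChoose (a + m) (a + 1) = m / (a + 1) * intChoose (a + m) a := by
    field_simp; linear_combination h0
  have x2 : intChoose (a + m) (a + 2) =
      m * (m - 1) / ((a + 1) * (a + 2)) * intChoose (a + m) a := by
    rw [x1] at h1
    field_simp at h1 ⊢; linear_combination h1
  have y1 : intChoose (a + m) (a - 1) = a / (m + 1) * intChoose (a + m) a := by
    field_simp; linear_combination -h2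
  have y2 : intChoose (a + m) (a - 1 - 1) =
      a * (a - 1) / ((m + 1) * (m + 2)) * intChoose (a + m) a := by
    rw [y1] at h3
    field_simp at h3 ⊢; linear_combination -h3
  have c0 := intChoose_natCast (a + m + 2) a
  have c1 := intChoose_natCast (a + m + 2) (a + 1)
  have c2 := intChoose_natCast (a + m + 2) (a + 2)
  have e1 : (a : ℤ) - 1 + 2 = a + 1 := by ring
  have e2 : (a : ℤ) - 1 - 1 + 2 = a := by ring
  have e3 : (a : ℤ) + 2 - 1 = a + 1 := by ring
  push_cast at c0 c1 c2
  simp only [intChoose, e3, add_sub_cancel_right, x1, x2, y1, y2] at c0 c1 c2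
  simp only [pathDet, e1, e2, sub_add_cancel, x1, x2, y1, y2, ← c0, ← c1, ← c2]
  push_cast
  field_simp
  ring

theorem viciousSum_one_one (n : ℕ) : viciousSum n 1 1 = baxter (n + 1) := by
  have hsub : (Function.support fun a : ℤ => pathDet n a (a - 1) (a - 1 - 1)) ⊆
      ((Finset.range (n + 1)).map Nat.castEmbedding : Finset ℤ) := by
    intro a ha
    by_contra hc
    refine ha ?_
    have : a < 0 ∨ (n : ℤ) < a := by
      by_contra! h
      exact hc (by simpa using ⟨a.toNat, by omega, by omega⟩)
    rcases this with h | h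
    · exact pathDet_eq_zero_of_lt (by omega) _ _
    · exact pathDet_eq_zero (Or.inr h) _ _
  rw [viciousSum, finsum_eq_sum_of_support_subset _ hsub, Finset.sum_map, baxter, Finset.mul_sum]
  refine Finset.sum_congr rfl fun a ha => ?_
  obtain ⟨m, rfl⟩ := Nat.exists_eq_add_of_le (Nat.lt_succ_iff.1 (Finset.mem_range.1 ha))
  exact pathDet_consecutive a m

section Walks

variable {S : Type*} (next : S → Finset S) (T : S → Prop)

/-- Walks of length `n` from `x` along the successor relation `next`, ending in `T`. -/
def Walks (n : ℕ) (x : S) : Type _ :=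
  {q : Fin (n + 1) → S //
    q 0 = x ∧ (∀ m : Fin n, q m.succ ∈ next (q m.castSucc)) ∧ T (q (Fin.last n))}

/-- Splitting off the first step of a walk. -/
def walksSuccEquiv (n : ℕ) (x : S) :
    Walks next T (n + 1) x ≃ Σ y : next x, Walks next T n y where
  toFun q := ⟨⟨q.1 1, by
      have h := q.2.2.1 0
      rwa [Fin.castSucc_zero, q.2.1] at h⟩, fun m => q.1 m.succ, rfl,
    fun m => q.2.2.1 m.succ, q.2.2.2⟩
  invFun r := ⟨Fin.cons x r.2.1, rfl, by
    intro m
    refine Fin.cases ?_ (fun m => ?_) m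
    · simp [r.2.2.1]
    · exact r.2.2.2.1 m, r.2.2.2.2⟩
  left_inv q := by
    refine Subtype.ext (funext fun m => ?_)
    refine Fin.cases ?_ (fun m => ?_) m
    · exact q.2.1.symm
    · rfl
  right_inv r := by
    obtain ⟨⟨_, hy⟩, r, hr⟩ := r
    obtain rfl := hr.1
    rfl

instance finite_walks (n : ℕ) (x : S) : Finite (Walks next T n x) := by
  induction n generalizing x with
  | zero =>
    have : Subsingleton (Walks next T 0 x) := by
      refine ⟨fun q r => Subtype.ext (funext fun m => ?_)⟩
      rw [Fin.eq_zero m, q.2.1, r.2.1]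
    infer_instance
  | succ n ih => exact Finite.of_equiv _ (walksSuccEquiv next T n x).symm

theorem card_walks_succ (n : ℕ) (x : S) :
    Nat.card (Walks next T (n + 1) x) = ∑ y ∈ next x, Nat.card (Walks next T n y) := by
  rw [Nat.card_congr (walksSuccEquiv next T n x), Nat.card_sigma,
    Finset.sum_coe_sort (next x) fun y => Nat.card (Walks next T n y)]

theorem card_walks_zero [DecidablePred T] (x : S) :
    Nat.card (Walks next T 0 x) = if T x then 1 else 0 := by
  split_ifs with h
  · rw [Nat.card_eq_one_iff_unique]
    refine ⟨⟨fun q r => Subtype.ext (funext fun m => ?_)⟩, ⟨fun _ => x, rfl, nofun, h⟩⟩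
    rw [Fin.eq_zero m, q.2.1, r.2.1]
  · rw [Nat.card_eq_zero]
    refine Or.inl ⟨fun q => h ?_⟩
    exact q.2.1 ▸ q.2.2.2

end Walks

/-- The positions reachable in one step by three osculating walkers. -/
def oscNext (u : ℤ × ℤ × ℤ) : Finset (ℤ × ℤ × ℤ) :=
  (({u.1 - 1, u.1 + 1} : Finset ℤ) ×ˢ ({u.2.1 - 1, u.2.1 + 1} : Finset ℤ) ×ˢ
      ({u.2.2 - 1, u.2.2 + 1} : Finset ℤ)).filter fun v =>
    (v.1 ≤ v.2.1 ∧ v.2.1 ≤ v.2.2) ∧ (u.1 = u.2.1 → v.1 < v.2.1) ∧ (u.2.1 = u.2.2 → v.2.1 < v.2.2)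

/-- The end condition with half-gaps `(1, 0)`. -/
def OscEnd (u : ℤ × ℤ × ℤ) : Prop := u.2.1 - u.1 = 2 ∧ u.2.2 = u.2.1

instance : DecidablePred OscEnd := fun u => by unfold OscEnd; infer_instance

theorem mem_oscNext {u v : ℤ × ℤ × ℤ} :
    v ∈ oscNext u ↔ ((v.1 = u.1 - 1 ∨ v.1 = u.1 + 1) ∧ (v.2.1 = u.2.1 - 1 ∨ v.2.1 = u.2.1 + 1) ∧
      (v.2.2 = u.2.2 - 1 ∨ v.2.2 = u.2.2 + 1)) ∧ (v.1 ≤ v.2.1 ∧ v.2.1 ≤ v.2.2) ∧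
      (u.1 = u.2.1 → v.1 < v.2.1) ∧ (u.2.1 = u.2.2 → v.2.1 < v.2.2) := by
  simp only [oscNext, Finset.mem_filter, Finset.mem_product, Finset.mem_insert,
    Finset.mem_singleton]

theorem sum_oscNext (f : ℤ × ℤ × ℤ → ℕ) (x y z : ℤ) {g : ℤ → ℤ → ℤ → ℕ}
    (hg : ∀ x' y' z', g x' y' z' =
      if (x' ≤ y' ∧ y' ≤ z') ∧ (x = y → x' < y') ∧ (y = z → y' < z') then f (x', y', z') else 0) :
    ∑ v ∈ oscNext (x, y, z), f v =
      g (x - 1) (y - 1) (z - 1) + g (x - 1) (y - 1) (z + 1)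
        + (g (x - 1) (y + 1) (z - 1) + g (x - 1) (y + 1) (z + 1))
        + (g (x + 1) (y - 1) (z - 1) + g (x + 1) (y - 1) (z + 1)
        + (g (x + 1) (y + 1) (z - 1) + g (x + 1) (y + 1) (z + 1))) := by
  have pair (w : ℤ) : w - 1 ≠ w + 1 := by omega
  rw [oscNext, Finset.sum_filter]
  simp only [← hg, Finset.sum_product, Finset.sum_pair (pair _)]

theorem card_walks_eq_oscCount (n : ℕ) : ∀ a k l : ℤ, 0 ≤ k → 0 ≤ l →
    Nat.card (Walks oscNext OscEnd n (a, a + 2 * k, a + 2 * k + 2 * l)) = oscCount n k l := by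
  induction n with
  | zero =>
    intro a k l _ _
    rw [card_walks_zero, oscCount]
    refine if_congr ?_ rfl rfl
    simp only [OscEnd]
    omega
  | succ n ih =>
    intro a k l hk hl
    have ih' (x y z a k l : ℤ) (hx : x = a) (hy : y = a + 2 * k) (hz : z = a + 2 * k + 2 * l)
        (hk : 0 ≤ k) (hl : 0 ≤ l) :
        Nat.card (Walks oscNext OscEnd n (x, y, z)) = oscCount n k l := by
      subst hx hy hz; exact ih _ _ _ hk hl
    rw [card_walks_succ, sum_oscNext _ _ _ _ fun _ _ _ => rfl]
    rcases hk.eq_or_lt with rfl | hk' <;> rcases hl.eq_or_lt with rfl | hl'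
    · rw [oscCount_succ_zero_zero, if_neg, if_neg, if_neg, if_neg,
        if_neg, if_neg, if_neg, if_neg]
      all_goals omega
    · rw [oscCount_succ_zero_left n hl', if_neg, if_neg, if_pos, if_pos,
        if_neg, if_neg, if_neg, if_neg,
        ih' _ _ _ (a - 1) 1 (l - 1) (by ring) (by ring) (by ring) (by omega) (by omega),
        ih' _ _ _ (a - 1) 1 l (by ring) (by ring) (by ring) (by omega) (by omega)]
      · ring
      all_goals omega
    · rw [oscCount_succ_zero_right n hk', if_neg, if_pos, if_neg, if_neg,
        if_neg, if_pos, if_neg, if_neg,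
        ih' _ _ _ (a - 1) k 1 (by ring) (by ring) (by ring) (by omega) (by omega),
        ih' _ _ _ (a + 1) (k - 1) 1 (by ring) (by ring) (by ring) (by omega) (by omega)]
      · ring
      all_goals omega
    · rw [oscCount_succ_of_pos n hk' hl', if_pos, if_pos, if_pos, if_pos,
        if_pos, if_pos, if_pos, if_pos,
        ih' _ _ _ (a - 1) k l (by ring) (by ring) (by ring) (by omega) (by omega),
        ih' _ _ _ (a - 1) k (l + 1) (by ring) (by ring) (by ring) (by omega) (by omega),
        ih' _ _ _ (a - 1) (k + 1) (l - 1) (by ring) (by ring) (by ring) (by omega) (by omega),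
        ih' _ _ _ (a - 1) (k + 1) l (by ring) (by ring) (by ring) (by omega) (by omega),
        ih' _ _ _ (a + 1) (k - 1) l (by ring) (by ring) (by ring) (by omega) (by omega),
        ih' _ _ _ (a + 1) (k - 1) (l + 1) (by ring) (by ring) (by ring) (by omega) (by omega),
        ih' _ _ _ (a + 1) k (l - 1) (by ring) (by ring) (by ring) (by omega) (by omega),
        ih' _ _ _ (a + 1) k l (by ring) (by ring) (by ring) (by omega) (by omega)]
      · ring
      all_goals omega

/-- Three simultaneous walks as one walk in `ℤ³`. -/
def tripleEquiv (I : Type*) : (Fin 3 → I → ℤ) ≃ (I → ℤ × ℤ × ℤ) where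
  toFun p m := (p 0 m, p 1 m, p 2 m)
  invFun q := ![fun m => (q m).1, fun m => (q m).2.1, fun m => (q m).2.2]
  left_inv p := by
    funext k m
    fin_cases k <;> rfl
  right_inv _ := rfl

theorem osculating_iff {n : ℕ} {p : Fin 3 → Fin (n + 1) → ℤ} (h : p 0 0 ≤ p 1 0 ∧ p 1 0 ≤ p 2 0) :
    Osculating p ↔ ∀ m : Fin n,
      tripleEquiv _ p m.succ ∈ oscNext (tripleEquiv _ p m.castSucc) := by
  have key (m : Fin n) : tripleEquiv _ p m.succ ∈ oscNext (tripleEquiv _ p m.castSucc) ↔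
      (∀ k, p k m.succ - p k m.castSucc = 1 ∨ p k m.succ - p k m.castSucc = -1) ∧
      (p 0 m.succ ≤ p 1 m.succ ∧ p 1 m.succ ≤ p 2 m.succ) ∧
      (p 0 m.castSucc = p 1 m.castSucc → p 0 m.succ < p 1 m.succ) ∧
      (p 1 m.castSucc = p 2 m.castSucc → p 1 m.succ < p 2 m.succ) := by
    rw [mem_oscNext]
    refine and_congr ?_ Iff.rfl
    simp only [Fin.forall_fin_succ, Fin.forall_fin_zero]
    have step (v w : ℤ) : (w = v - 1 ∨ w = v + 1) ↔ (w - v = 1 ∨ w - v = -1) := by omega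
    rw [and_true]
    exact and_congr (step _ _) (and_congr (step _ _) (step _ _))
  simp only [key]
  constructor
  · rintro ⟨h1, h2, h3⟩ m
    exact ⟨fun k => h1 k m, h2 m.succ, h3 m⟩
  · intro H
    exact ⟨fun k m => (H m).1 k, Fin.cases h fun m => (H m).2.1, fun m => (H m).2.2⟩

theorem card_osculating_stars (n : ℕ) :
    Nat.card {p : Fin 3 → Fin (n + 1) → ℤ // Osculating p ∧ Starts 1 1 p ∧
      p 1 (Fin.last n) - p 0 (Fin.last n) = 2 ∧
      p 2 (Fin.last n) = p 1 (Fin.last n)} = oscCount n 1 1 := by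
  rw [← card_walks_eq_oscCount n 0 1 1 zero_le_one zero_le_one]
  refine Nat.card_congr ((tripleEquiv _).subtypeEquiv fun p => ?_)
  have hs : Starts 1 1 p ↔ tripleEquiv _ p 0 = (0, 0 + 2 * 1, 0 + 2 * 1 + 2 * 1) := by
    change _ ↔ (p 0 0, p 1 0, p 2 0) = _
    norm_num [Starts, Prod.ext_iff]
  rw [and_left_comm, ← hs]
  refine and_congr_right fun h => and_congr (osculating_iff ?_) Iff.rfl
  obtain ⟨h0, h1, h2⟩ := h
  push_cast at h1 h2
  omega

theorem osculating_one_one_k_one_l_zero_baxter :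
    PowerSeries.X * (1 + PowerSeries.X) * F1110 =
      (1 - PowerSeries.X) * baxterGF - PowerSeries.X := by
  have b1 : baxter 1 = 1 := by
    simp [baxter]; norm_num
  ext n
  simp only [F1110, card_osculating_stars]
  rw [mul_assoc, add_mul, sub_mul, one_mul, one_mul, map_sub, map_sub]
  rcases n with - | n
  · simp [baxterGF]
  rw [PowerSeries.coeff_succ_X_mul, PowerSeries.coeff_succ_X_mul, map_add, PowerSeries.coeff_mk]
  rcases n with - | n
  · simp [baxterGF, b1, oscCount]
  rw [PowerSeries.coeff_succ_X_mul, PowerSeries.coeff_mk, oscCount_add_oscCount,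
    viciousSum_one_one, viciousSum_one_one]
  simp [baxterGF, PowerSeries.coeff_X]
end

section
/- Let W(t) = Σ_{n≥0} o_{1,1}^{(1,1)}(n) t^n ∈ ℚ[[t]], where o_{1,1}^{(1,1)}(n) is the number of osculating (1,1)-stars of length n with j_{n,2}−j_{n,1}=2 and j_{n,3}−j_{n,2}=2 (osculating watermelons), and let B(t) = Σ_{n≥1} b_n t^n be the generating function of the Baxter numbers. Then t^2(1+t)·W(t) = (1−t)·((1−t)·B(t) − t). -/
/-- `W(t) = Σ_n o_{1,1}^{(1,1)}(n) t^n`, the generating function of osculating watermelons. -/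
noncomputable def Wmelon : PowerSeries ℚ :=
  PowerSeries.mk fun n =>
    (Nat.card {p : Fin 3 → Fin (n + 1) → ℤ // Osculating p ∧ Starts 1 1 p ∧
      p 1 (Fin.last n) - p 0 (Fin.last n) = 2 ∧
      p 2 (Fin.last n) - p 1 (Fin.last n) = 2} : ℚ)

/-- The binomial coefficient `C(n,k)`, extended by zero to all integers `k`. -/
def pascal : ℕ → ℤ → ℤ
  | 0, k => if k = 0 then 1 else 0
  | n + 1, k => pascal n k + pascal n (k - 1)

lemma pascal_of_neg (n : ℕ) {k : ℤ} (hk : k < 0) : pascal n k = 0 := by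
  induction n generalizing k with
  | zero => simp [pascal, hk.ne]
  | succ n ih => rw [pascal, ih hk, ih (by omega), add_zero]

lemma pascal_of_lt (n : ℕ) {k : ℤ} (hk : n < k) : pascal n k = 0 := by
  induction n generalizing k with
  | zero => simp only [pascal, ite_eq_right_iff]; omega
  | succ n ih => rw [pascal, ih (by omega), ih (by omega), add_zero]

lemma pascal_natCast (n k : ℕ) : pascal n k = n.choose k := by
  induction n generalizing k with
  | zero => cases k <;> simp [pascal]; omega
  | succ n ih =>
    cases k with
    | zero => simpa [pascal, pascal_of_neg] using ih 0
    | succ k =>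
      have h := ih (k + 1)
      rw [pascal, h, Nat.choose_succ_succ]
      push_cast
      rw [add_sub_cancel_right, ih, add_comm]

lemma add_one_mul_pascal (n : ℕ) (k : ℤ) :
    (k + 1) * pascal n (k + 1) = (n - k) * pascal n k := by
  induction n generalizing k with
  | zero =>
    simp only [pascal]
    split_ifs <;> grind
  | succ n ih =>
    have h := ih (k - 1)
    rw [sub_add_cancel] at h
    rw [pascal, pascal, add_sub_cancel_right]
    push_cast
    linear_combination ih k + h

/-- The Lindström–Gessel–Viennot determinant `det [C(n, a_i - k)]`, counting the triples of
vicious walkers of length `n` which start at adjacent points and whose numbers of up steps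
lead them to `a`, `b`, `c`. -/
def viciousDet (n : ℕ) (a b c : ℤ) : ℤ :=
  pascal n a * (pascal n (b - 1) * pascal n (c - 2) - pascal n (b - 2) * pascal n (c - 1))
    - pascal n (a - 1) * (pascal n b * pascal n (c - 2) - pascal n (b - 2) * pascal n c)
    + pascal n (a - 2) * (pascal n b * pascal n (c - 1) - pascal n (b - 1) * pascal n c)

lemma viciousDet_succ (n : ℕ) (a b c : ℤ) :
    viciousDet (n + 1) a b c =
      viciousDet n a b c + viciousDet n (a - 1) (b - 1) (c - 1)
      + viciousDet n (a - 1) b c + viciousDet n a (b - 1) c + viciousDet n a b (c - 1)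
      + viciousDet n (a - 1) (b - 1) c + viciousDet n (a - 1) b (c - 1)
      + viciousDet n a (b - 1) (c - 1) := by
  have h1 (k : ℤ) : k - 1 - 1 = k - 2 := by ring
  have h2 (k : ℤ) : k - 2 - 1 = k - 3 := by ring
  have h3 (k : ℤ) : k - 1 - 2 = k - 3 := by ring
  simp only [viciousDet, pascal, h1, h2, h3]
  ring

lemma viciousDet_of_neg (n : ℕ) {a : ℤ} (b c : ℤ) (ha : a < 0) : viciousDet n a b c = 0 := by
  simp [viciousDet, pascal_of_neg n ha, pascal_of_neg n (show a - 1 < 0 by omega),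
    pascal_of_neg n (show a - 2 < 0 by omega)]

lemma viciousDet_of_lt_left (n : ℕ) {a : ℤ} (b c : ℤ) (ha : n + 2 < a) :
    viciousDet n a b c = 0 := by
  simp [viciousDet, pascal_of_lt n (show (n : ℤ) < a by omega),
    pascal_of_lt n (show (n : ℤ) < a - 1 by omega),
    pascal_of_lt n (show (n : ℤ) < a - 2 by omega)]

lemma viciousDet_of_lt_right (n : ℕ) (a b : ℤ) {c : ℤ} (hc : n + 2 < c) :
    viciousDet n a b c = 0 := by
  simp [viciousDet, pascal_of_lt n (show (n : ℤ) < c by omega),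
    pascal_of_lt n (show (n : ℤ) < c - 1 by omega),
    pascal_of_lt n (show (n : ℤ) < c - 2 by omega)]

/-- The number of vicious triples of length `n` with initial gaps `(2, 2)` and final gaps
`(2x, 2y)`, extended antisymmetrically beyond `x, y ≥ 0`. -/
noncomputable def viciousNum (n : ℕ) (x y : ℤ) : ℤ :=
  ∑' a : ℤ, viciousDet n a (a + x) (a + x + y)

lemma hasSum_viciousNum (n : ℕ) (x y : ℤ) :
    HasSum (fun a : ℤ => viciousDet n a (a + x) (a + x + y)) (viciousNum n x y) := by
  refine (summable_of_hasFiniteSupport ((Set.finite_Icc (0 : ℤ) (n + 2)).subset ?_)).hasSum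
  intro a ha
  by_contra h
  rw [Set.mem_Icc, not_and_or, not_le, not_le] at h
  exact ha (h.elim (viciousDet_of_neg n _ _) (viciousDet_of_lt_left n _ _))

lemma hasSum_viciousNum_shift (n : ℕ) (x y : ℤ) :
    HasSum (fun a : ℤ => viciousDet n (a - 1) (a - 1 + x) (a - 1 + x + y))
      (viciousNum n x y) :=
  (Equiv.hasSum_iff (Equiv.subRight (1 : ℤ))
    (f := fun a : ℤ => viciousDet n a (a + x) (a + x + y))).mpr (hasSum_viciousNum n x y)

lemma viciousNum_succ (n : ℕ) (x y : ℤ) :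
    viciousNum (n + 1) x y =
      2 * viciousNum n x y + viciousNum n (x + 1) y + viciousNum n (x - 1) (y + 1)
      + viciousNum n x (y - 1) + viciousNum n x (y + 1) + viciousNum n (x + 1) (y - 1)
      + viciousNum n (x - 1) y := by
  have h := ((((((((hasSum_viciousNum n x y).add (hasSum_viciousNum_shift n x y)).add
    (hasSum_viciousNum_shift n (x + 1) y)).add (hasSum_viciousNum n (x - 1) (y + 1))).add
    (hasSum_viciousNum n x (y - 1))).add (hasSum_viciousNum_shift n x (y + 1))).add
    (hasSum_viciousNum_shift n (x + 1) (y - 1))).add (hasSum_viciousNum n (x - 1) y))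
  rw [two_mul]
  refine (hasSum_viciousNum (n + 1) x y).unique (h.congr_fun ?_)
  intro a
  rw [viciousDet_succ]
  ring_nf

lemma viciousNum_zero_left (n : ℕ) (y : ℤ) : viciousNum n 0 y = 0 := by
  have h (a : ℤ) : viciousDet n a (a + 0) (a + 0 + y) = 0 := by
    rw [viciousDet, add_zero]; ring
  simp only [viciousNum, h, tsum_zero]

lemma viciousNum_zero_right (n : ℕ) (x : ℤ) : viciousNum n x 0 = 0 := by
  have h (a : ℤ) : viciousDet n a (a + x) (a + x + 0) = 0 := by
    rw [viciousDet, add_zero]; ring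
  simp only [viciousNum, h, tsum_zero]

lemma viciousNum_zero {x y : ℤ} (hx : 0 ≤ x) (hy : 0 ≤ y) :
    viciousNum 0 x y = if x = 1 ∧ y = 1 then 1 else 0 := by
  rw [viciousNum, tsum_eq_single 0]
  · simp only [viciousDet, pascal]
    split_ifs <;> omega
  · intro a ha
    simp only [viciousDet, pascal]
    split_ifs <;> omega

lemma viciousDet_adjacent (r s : ℕ) :
    (viciousDet (r + s) r (r + 1) (r + 2) : ℚ) =
      2 / (((r + s + 1 : ℕ) : ℚ) * (((r + s + 1 : ℕ) : ℚ) + 1) ^ 2) *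
        ((r + s + 2).choose r * (r + s + 2).choose (r + 1) * (r + s + 2).choose (r + 2)) := by
  have hr : (r : ℚ) + 1 ≠ 0 := by positivity
  have hr' : (r : ℚ) + 2 ≠ 0 := by positivity
  have hs : (s : ℚ) + 1 ≠ 0 := by positivity
  have hs' : (s : ℚ) + 2 ≠ 0 := by positivity
  have q1 : (pascal (r + s) (r + 1) : ℚ) = s / (r + 1) * pascal (r + s) r := by
    have h := congrArg (Int.cast (R := ℚ)) (add_one_mul_pascal (r + s) r)
    push_cast at h
    field_simp
    linear_combination h
  have q2 : (pascal (r + s) (r + 2) : ℚ) = (s - 1) / (r + 2) * pascal (r + s) (r + 1) := by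
    have h := congrArg (Int.cast (R := ℚ)) (add_one_mul_pascal (r + s) (r + 1))
    rw [add_assoc, one_add_one_eq_two] at h
    push_cast at h
    field_simp
    linear_combination h
  have q3 : (pascal (r + s) (r - 1) : ℚ) = r / (s + 1) * pascal (r + s) r := by
    have h := congrArg (Int.cast (R := ℚ)) (add_one_mul_pascal (r + s) (r - 1))
    rw [sub_add_cancel] at h
    push_cast at h
    field_simp
    linear_combination -h
  have q4 : (pascal (r + s) (r - 2) : ℚ) = (r - 1) / (s + 2) * pascal (r + s) (r - 1) := by
    have h := congrArg (Int.cast (R := ℚ)) (add_one_mul_pascal (r + s) (r - 2))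
    rw [show (r - 2 + 1 : ℤ) = r - 1 by ring] at h
    push_cast at h
    field_simp
    linear_combination -h
  have c0 : ((r + s + 2).choose r : ℚ) = (pascal (r + s + 2) r : ℤ) := by
    rw [pascal_natCast]; norm_cast
  have c1 : ((r + s + 2).choose (r + 1) : ℚ) = (pascal (r + s + 2) (r + 1) : ℤ) := by
    rw [← Nat.cast_add_one, pascal_natCast]; norm_cast
  have c2 : ((r + s + 2).choose (r + 2) : ℚ) = (pascal (r + s + 2) (r + 2) : ℤ) := by
    exact_mod_cast (pascal_natCast (r + s + 2) (r + 2)).symm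
  rw [c0, c1, c2]
  have e1 : (r + 2 - 1 : ℤ) = r + 1 := by ring
  have e2 : (r + 1 - 2 : ℤ) = r - 1 := by ring
  have e3 : (r - 1 - 1 : ℤ) = r - 2 := by ring
  simp only [viciousDet, pascal, e1, e2, e3, add_sub_cancel_right]
  push_cast
  simp only [q2, q4, q1, q3]
  field_simp
  ring

lemma viciousNum_one_one (n : ℕ) : (viciousNum n 1 1 : ℚ) = baxter (n + 1) := by
  have h : viciousNum n 1 1 = ∑ r ∈ Finset.range (n + 1), viciousDet n r (r + 1) (r + 2) := by
    rw [viciousNum, tsum_eq_sum (s := (Finset.range (n + 1)).map Nat.castEmbedding)]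
    · simp [add_assoc]
    · intro a ha
      rcases lt_or_ge a 0 with h0 | h0
      · exact viciousDet_of_neg n _ _ h0
      · lift a to ℕ using h0
        refine viciousDet_of_lt_right n _ _ ?_
        simp at ha
        omega
  rw [h, baxter, Int.cast_sum, Finset.mul_sum]
  refine Finset.sum_congr rfl fun r hr => ?_
  obtain ⟨s, rfl⟩ := Nat.exists_eq_add_of_le (Nat.lt_succ_iff.mp (Finset.mem_range.mp hr))
  exact viciousDet_adjacent r s

/-- `p` is an osculating `(1,1)`-star with final gaps `(2x, 2y)`. -/
def IsOscStar {n : ℕ} (x y : ℤ) (p : Fin 3 → Fin (n + 1) → ℤ) : Prop :=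
  Osculating p ∧ Starts 1 1 p ∧
    p 1 (Fin.last n) - p 0 (Fin.last n) = 2 * x ∧
    p 2 (Fin.last n) - p 1 (Fin.last n) = 2 * y

/-- The number of osculating `(1,1)`-stars of length `n` with final gaps `(2x, 2y)`. -/
noncomputable def oscNum (n : ℕ) (x y : ℤ) : ℕ :=
  Nat.card {p : Fin 3 → Fin (n + 1) → ℤ // IsOscStar x y p}

/-- Extend three walks by one step each: up where `e` is true, down where it is false. -/
def extendWalks {n : ℕ} (e : Fin 3 → Bool) (q : Fin 3 → Fin (n + 1) → ℤ) :
    Fin 3 → Fin (n + 2) → ℤ :=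
  fun k => Fin.snoc (α := fun _ => ℤ) (q k) (q k (Fin.last n) + if e k then 1 else -1)

@[simp] lemma extendWalks_castSucc {n : ℕ} (e : Fin 3 → Bool) (q : Fin 3 → Fin (n + 1) → ℤ)
    (k : Fin 3) (m : Fin (n + 1)) : extendWalks e q k m.castSucc = q k m := by
  simp [extendWalks]

@[simp] lemma extendWalks_last {n : ℕ} (e : Fin 3 → Bool) (q : Fin 3 → Fin (n + 1) → ℤ)
    (k : Fin 3) : extendWalks e q k (Fin.last (n + 1)) =
      q k (Fin.last n) + if e k then 1 else -1 := by
  simp [extendWalks]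

@[simp] lemma extendWalks_zero {n : ℕ} (e : Fin 3 → Bool) (q : Fin 3 → Fin (n + 1) → ℤ)
    (k : Fin 3) : extendWalks e q k 0 = q k 0 := by
  rw [← Fin.castSucc_zero, extendWalks_castSucc]

/-- The first gap before the step `e`, in terms of the gap `x` after it. -/
abbrev prevLeft (e : Fin 3 → Bool) (x : ℤ) : ℤ := x + (e 0).toInt - (e 1).toInt

/-- The second gap before the step `e`, in terms of the gap `y` after it. -/
abbrev prevRight (e : Fin 3 → Bool) (y : ℤ) : ℤ := y + (e 1).toInt - (e 2).toInt

/-- The step `e` may lead to the gaps `(2x, 2y)` in an osculating configuration. -/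
abbrev StepAllowed (e : Fin 3 → Bool) (x y : ℤ) : Prop :=
  0 ≤ x ∧ 0 ≤ y ∧ (prevLeft e x = 0 → 0 < x) ∧ (prevRight e y = 0 → 0 < y)

lemma isOscStar_extendWalks {n : ℕ} (e : Fin 3 → Bool) (q : Fin 3 → Fin (n + 1) → ℤ) (x y : ℤ) :
    IsOscStar x y (extendWalks e q) ↔
      StepAllowed e x y ∧ IsOscStar (prevLeft e x) (prevRight e y) q := by
  simp only [IsOscStar, Osculating, IsSteps, NonCrossing, Starts,
    Fin.forall_fin_succ' (n := n), Fin.forall_fin_succ' (n := n + 1), Fin.succ_castSucc,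
    Fin.succ_last, extendWalks_castSucc, extendWalks_last, extendWalks_zero]
  have hint (k : Fin 3) : (if e k then 1 else -1 : ℤ) = 2 * (e k).toInt - 1 := by
    cases e k <;> rfl
  have hbit (k : Fin 3) : (e k).toInt = 0 ∨ (e k).toInt = 1 := by
    cases e k <;> simp
  have hstep (k : Fin 3) :
      (q k (Fin.last n) + (2 * (e k).toInt - 1) - q k (Fin.last n) = 1 ∨
        q k (Fin.last n) + (2 * (e k).toInt - 1) - q k (Fin.last n) = -1) := by
    have := hbit k
    omega
  have h0 := hbit 0
  have h1 := hbit 1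
  have h2 := hbit 2
  simp only [hint, StepAllowed, prevLeft, prevRight]
  simp only [hstep, and_true]
  clear hstep hint hbit
  constructor
  · rintro ⟨⟨hs, ⟨hc, hc'⟩, ho, ho'⟩, hi, hx, hy⟩
    exact ⟨by refine ⟨?_, ?_, ?_, ?_⟩ <;> omega, ⟨hs, hc, ho⟩, hi, by omega, by omega⟩
  · rintro ⟨ha, ⟨hs, hc, ho⟩, hi, hx, hy⟩
    refine ⟨⟨hs, ⟨hc, ?_⟩, ho, ?_⟩, hi, ?_, ?_⟩ <;> omega

lemma extendWalks_injective {n : ℕ} {e e' : Fin 3 → Bool} {q q' : Fin 3 → Fin (n + 1) → ℤ}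
    (h : extendWalks e q = extendWalks e' q') : e = e' ∧ q = q' := by
  have hq : q = q' := by
    ext k m
    simpa using congrFun (congrFun h k) m.castSucc
  refine ⟨?_, hq⟩
  subst hq
  ext k
  have := congrFun (congrFun h k) (Fin.last (n + 1))
  revert this
  cases h1 : e k <;> cases h2 : e' k <;> simp [h1, h2]

lemma exists_eq_extendWalks {n : ℕ} {p : Fin 3 → Fin (n + 2) → ℤ} (hp : ∀ k, IsSteps (p k)) :
    ∃ e q, p = extendWalks e q := by
  refine ⟨fun k => decide (p k (Fin.last _) - p k (Fin.last n).castSucc = 1),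
    fun k m => p k m.castSucc, ?_⟩
  ext k m
  induction m using Fin.lastCases with
  | cast m => simp
  | last =>
    have : p k (Fin.last (n + 1)) - p k (Fin.last n).castSucc = 1 ∨
        p k (Fin.last (n + 1)) - p k (Fin.last n).castSucc = -1 := hp k (Fin.last n)
    rw [extendWalks_last]
    simp only [decide_eq_true_eq]
    split_ifs <;> omega

/-- Removing the last step of an osculating star. -/
noncomputable def oscStarEquiv (n : ℕ) (x y : ℤ) :
    (Σ e : Fin 3 → Bool, {q : Fin 3 → Fin (n + 1) → ℤ //
      StepAllowed e x y ∧ IsOscStar (prevLeft e x) (prevRight e y) q}) ≃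
    {p : Fin 3 → Fin (n + 2) → ℤ // IsOscStar x y p} :=
  Equiv.ofBijective
    (fun s => ⟨extendWalks s.1 s.2.1, (isOscStar_extendWalks _ _ _ _).mpr s.2.2⟩) <| by
    constructor
    · rintro ⟨e, q, hq⟩ ⟨e', q', hq'⟩ h
      obtain ⟨rfl, rfl⟩ := extendWalks_injective (congrArg Subtype.val h)
      rfl
    · rintro ⟨p, hp⟩
      obtain ⟨e, q, rfl⟩ := exists_eq_extendWalks hp.1.1
      exact ⟨⟨e, q, (isOscStar_extendWalks _ _ _ _).mp hp⟩, rfl⟩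

lemma isOscStar_zero_iff (x y : ℤ) (p : Fin 3 → Fin 1 → ℤ) :
    IsOscStar x y p ↔ (x = 1 ∧ y = 1) ∧ p = fun (k : Fin 3) _ => 2 * ((k : ℕ) : ℤ) := by
  constructor
  · rintro ⟨-, ⟨h0, h1, h2⟩, hx, hy⟩
    simp only [Fin.last_zero] at hx hy
    refine ⟨by push_cast at *; omega, ?_⟩
    ext k m
    rw [Subsingleton.elim m 0]
    fin_cases k
    · simpa using h0
    · simpa using h1
    · simpa using h2
  · rintro ⟨⟨rfl, rfl⟩, rfl⟩
    simp [IsOscStar, Osculating, IsSteps, NonCrossing, Starts]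

lemma oscNum_zero (x y : ℤ) : oscNum 0 x y = if x = 1 ∧ y = 1 then 1 else 0 := by
  simp only [oscNum, isOscStar_zero_iff]
  split_ifs with h <;> simp [h]

instance finite_isOscStar (n : ℕ) (x y : ℤ) :
    Finite {p : Fin 3 → Fin (n + 1) → ℤ // IsOscStar x y p} := by
  induction n generalizing x y with
  | zero =>
    refine Set.Finite.subset (Set.finite_singleton fun (k : Fin 3) _ => 2 * ((k : ℕ) : ℤ)) ?_
    exact fun p hp => ((isOscStar_zero_iff x y p).mp hp).2
  | succ n ih =>
    have (e : Fin 3 → Bool) : Finite {q : Fin 3 → Fin (n + 1) → ℤ //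
        StepAllowed e x y ∧ IsOscStar (prevLeft e x) (prevRight e y) q} :=
      Finite.of_injective _ (Subtype.impEmbedding _ _ fun _ h => h.2).injective
    exact Finite.of_equiv _ (oscStarEquiv n x y)

lemma oscNum_succ_eq_sum (n : ℕ) (x y : ℤ) :
    oscNum (n + 1) x y = ∑ e : Fin 3 → Bool,
      if StepAllowed e x y then oscNum n (prevLeft e x) (prevRight e y) else 0 := by
  have (e : Fin 3 → Bool) : Finite {q : Fin 3 → Fin (n + 1) → ℤ //
      StepAllowed e x y ∧ IsOscStar (prevLeft e x) (prevRight e y) q} :=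
    Finite.of_injective _ (Subtype.impEmbedding _ _ fun _ h => h.2).injective
  rw [oscNum, ← Nat.card_congr (oscStarEquiv n x y), Nat.card_sigma]
  refine Finset.sum_congr rfl fun e _ => ?_
  split_ifs with h
  · exact Nat.card_congr (Equiv.subtypeEquivRight fun q => and_iff_right h)
  · simp [h]

lemma sum_fin_three_bool (f : (Fin 3 → Bool) → ℕ) :
    ∑ e, f e = f ![false, false, false] + f ![true, true, true]
      + f ![true, false, false] + f ![false, true, false] + f ![false, false, true]
      + f ![true, true, false] + f ![true, false, true] + f ![false, true, true] := by
  have h : (Finset.univ : Finset (Fin 3 → Bool)) =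
      {![false, false, false], ![true, true, true], ![true, false, false], ![false, true, false],
        ![false, false, true], ![true, true, false], ![true, false, true],
        ![false, true, true]} := by decide
  rw [h]
  repeat rw [Finset.sum_insert (by decide)]
  rw [Finset.sum_singleton]
  ring

lemma oscNum_of_neg (n : ℕ) {x y : ℤ} (h : x < 0 ∨ y < 0) : oscNum n x y = 0 := by
  cases n with
  | zero => rw [oscNum_zero, if_neg (by omega)]
  | succ n =>
    rw [oscNum_succ_eq_sum]
    exact Finset.sum_eq_zero fun e _ => if_neg (by omega)

lemma oscNum_zero_zero (n : ℕ) : oscNum n 0 0 = 0 := by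
  cases n with
  | zero => simp [oscNum_zero]
  | succ n =>
    rw [oscNum_succ_eq_sum, sum_fin_three_bool]
    simp [StepAllowed, prevLeft, prevRight, oscNum_of_neg]

lemma oscNum_succ_zero_left (n : ℕ) {y : ℤ} (hy : 1 ≤ y) :
    oscNum (n + 1) 0 y = oscNum n 1 y + oscNum n 1 (y - 1) := by
  rw [oscNum_succ_eq_sum, sum_fin_three_bool]
  have h0 : 0 ≤ y := by omega
  have h1 : 0 < y := by omega
  simp [StepAllowed, prevLeft, prevRight, oscNum_of_neg, h0, h1]

lemma oscNum_succ_zero_right (n : ℕ) {x : ℤ} (hx : 1 ≤ x) :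
    oscNum (n + 1) x 0 = oscNum n x 1 + oscNum n (x - 1) 1 := by
  rw [oscNum_succ_eq_sum, sum_fin_three_bool]
  have h0 : 0 ≤ x := by omega
  have h1 : 0 < x := by omega
  simp [StepAllowed, prevLeft, prevRight, oscNum_of_neg, h0, h1]
  ring

lemma oscNum_succ (n : ℕ) {x y : ℤ} (hx : 1 ≤ x) (hy : 1 ≤ y) :
    oscNum (n + 1) x y =
      2 * oscNum n x y + oscNum n (x + 1) y + oscNum n (x - 1) (y + 1)
      + oscNum n x (y - 1) + oscNum n x (y + 1) + oscNum n (x + 1) (y - 1)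
      + oscNum n (x - 1) y := by
  rw [oscNum_succ_eq_sum, sum_fin_three_bool]
  have h0 : 0 ≤ x := by omega
  have h1 : 0 < x := by omega
  have h2 : 0 ≤ y := by omega
  have h3 : 0 < y := by omega
  simp [StepAllowed, prevLeft, prevRight, h0, h1, h2, h3]
  ring

/-- Osculating stars in terms of vicious ones: the operator `f ↦ f(x,y) + f(x+1,y) + f(x,y+1)`
intertwines the vicious and the osculating evolutions. -/
lemma oscNum_succ_add_oscNum (n : ℕ) {x y : ℤ} (hx : 0 ≤ x) (hy : 0 ≤ y) :
    (oscNum (n + 1) x y + oscNum n x y : ℤ) =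
      (viciousNum (n + 1) x y - viciousNum n x y)
      + (viciousNum (n + 1) (x + 1) y - viciousNum n (x + 1) y)
      + (viciousNum (n + 1) x (y + 1) - viciousNum n x (y + 1)) := by
  induction n generalizing x y with
  | zero =>
    have hx' : x = 0 ∨ x = 1 ∨ x = 2 ∨ 3 ≤ x := by omega
    have hy' : y = 0 ∨ y = 1 ∨ y = 2 ∨ 3 ≤ y := by omega
    rcases hx.eq_or_lt with rfl | hx
    · rcases hy.eq_or_lt with rfl | hy
      · simp [oscNum_zero_zero, viciousNum_zero_left, viciousNum_zero_right]
      simp only [oscNum_succ_zero_left 0 hy, viciousNum_zero_left, viciousNum_succ 0 (0 + 1)]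
      simp (disch := omega) only [oscNum_zero, viciousNum_zero]
      rcases hy' with rfl | rfl | rfl | hy' <;>
        simp (disch := omega) only [if_neg, if_pos] <;> rfl
    · rcases hy.eq_or_lt with rfl | hy
      · simp only [oscNum_succ_zero_right 0 hx, viciousNum_zero_right, viciousNum_succ 0 x (0 + 1)]
        simp (disch := omega) only [oscNum_zero, viciousNum_zero]
        rcases hx' with rfl | rfl | rfl | hx' <;>
          simp (disch := omega) only [if_neg, if_pos] <;> rfl
      rw [oscNum_succ 0 hx hy]
      simp (disch := omega) only [viciousNum_succ, oscNum_zero, viciousNum_zero]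
      rcases hx' with rfl | rfl | rfl | hx' <;> rcases hy' with rfl | rfl | rfl | hy' <;>
        simp (disch := omega) only [if_neg] <;> rfl
  | succ n ih =>
    rcases hx.eq_or_lt with rfl | hx
    · rcases hy.eq_or_lt with rfl | hy
      · simp [oscNum_zero_zero, viciousNum_zero_left, viciousNum_zero_right]
      rw [oscNum_succ_zero_left _ hy, oscNum_succ_zero_left _ hy]
      have h0 := ih zero_le_one hy.le
      have h1 := ih zero_le_one (show 0 ≤ y - 1 by omega)
      have h2 := viciousNum_succ (n + 1) 1 y
      have h3 := viciousNum_succ n 1 y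
      simp only [viciousNum_zero_left, zero_add, sub_self, sub_add_cancel] at *
      push_cast
      linarith
    · rcases hy.eq_or_lt with rfl | hy
      · rw [oscNum_succ_zero_right _ hx, oscNum_succ_zero_right _ hx]
        have h0 := ih hx.le zero_le_one
        have h1 := ih (show 0 ≤ x - 1 by omega) zero_le_one
        have h2 := viciousNum_succ (n + 1) x 1
        have h3 := viciousNum_succ n x 1
        simp only [viciousNum_zero_right, zero_add, sub_self, sub_add_cancel] at *
        push_cast
        linarith
      have u0 := congrArg (Nat.cast (R := ℤ)) (oscNum_succ (n + 1) hx hy)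
      have u1 := congrArg (Nat.cast (R := ℤ)) (oscNum_succ n hx hy)
      have h0 := ih hx.le hy.le
      have h1 := ih (show 0 ≤ x + 1 by omega) hy.le
      have h2 := ih (show 0 ≤ x - 1 by omega) (show 0 ≤ y + 1 by omega)
      have h3 := ih hx.le (show 0 ≤ y - 1 by omega)
      have h4 := ih hx.le (show 0 ≤ y + 1 by omega)
      have h5 := ih (show 0 ≤ x + 1 by omega) (show 0 ≤ y - 1 by omega)
      have h6 := ih (show 0 ≤ x - 1 by omega) hy.le
      have v0 := viciousNum_succ (n + 1) x y
      have v1 := viciousNum_succ (n + 1) (x + 1) y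
      have v2 := viciousNum_succ (n + 1) x (y + 1)
      have v3 := viciousNum_succ n x y
      have v4 := viciousNum_succ n (x + 1) y
      have v5 := viciousNum_succ n x (y + 1)
      simp only [sub_add_cancel, add_sub_cancel_right] at *
      push_cast at u0 u1
      linarith

lemma oscNum_one_one (n : ℕ) :
    (oscNum (n + 1) 1 1 + oscNum n 1 1 : ℚ) =
      baxter (n + 3) - 2 * baxter (n + 2) + baxter (n + 1) := by
  have h := oscNum_succ_add_oscNum n zero_le_one zero_le_one
  have h0 := viciousNum_succ n 1 1
  have h1 := viciousNum_succ (n + 1) 1 1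
  simp only [sub_self, viciousNum_zero_left, viciousNum_zero_right] at h0 h1
  rw [← viciousNum_one_one, ← viciousNum_one_one, ← viciousNum_one_one]
  have h2 : (oscNum (n + 1) 1 1 + oscNum n 1 1 : ℤ) =
      viciousNum (n + 2) 1 1 - 2 * viciousNum (n + 1) 1 1 + viciousNum n 1 1 := by linarith
  exact_mod_cast h2

theorem osculating_watermelon_gf_baxter :
    PowerSeries.X ^ 2 * (1 + PowerSeries.X) * Wmelon =
      (1 - PowerSeries.X) * ((1 - PowerSeries.X) * baxterGF - PowerSeries.X) := by
  have hW : Wmelon = PowerSeries.mk fun n => (oscNum n 1 1 : ℚ) := rfl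
  have hl : PowerSeries.X ^ 2 * (1 + PowerSeries.X) * Wmelon =
      PowerSeries.X ^ 2 * Wmelon + PowerSeries.X ^ 3 * Wmelon := by ring
  have hr : (1 - PowerSeries.X) * ((1 - PowerSeries.X) * baxterGF - PowerSeries.X) =
      baxterGF - PowerSeries.X ^ 1 * (baxterGF + baxterGF) + PowerSeries.X ^ 2 * baxterGF
        - PowerSeries.X + PowerSeries.X ^ 2 := by ring
  rw [hl, hr, hW]
  ext n
  simp only [map_add, map_sub, PowerSeries.coeff_X_pow_mul', PowerSeries.coeff_X,
    PowerSeries.coeff_X_pow, PowerSeries.coeff_mk, baxterGF]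
  have hb1 : baxter 1 = 1 := by norm_num [baxter]
  have hb2 : baxter 2 = 2 := by norm_num [baxter, Finset.sum_range_succ]
  match n with
  | 0 => simp
  | 1 => simp [hb1]
  | 2 => norm_num [hb1, hb2, oscNum_zero]
  | n + 3 =>
    have h := oscNum_one_one n
    simp
    linarith
end

section
/- For every integer i ≥ 1, the complete generating functions of osculating and vicious i-stars of two walkers satisfy, as an identity in ℚ[u][[t]][x] after clearing the denominator x: ((1+ut)^2 − u)·x·O_i(t;u,x) = x^{i+1}·(1−u+2tu + xtu(1−u)) + t·(1+2x+x^2(1−u))·( (1−u+2tu)·V_i(t;x) + tu·V_{i+1}(t;x) ). In particular, at u = 1: (2+t)·x·O_i(t;1,x) = 2x^{i+1} + t·(1+2x)·( 2·V_i(t;x) + V_{i+1}(t;x) ). -/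
/-- An osculating configuration of two walkers: two `±1`-step walks, non-crossing,
and whenever the walkers meet at time `m < n` they separate at time `m+1`. -/
def Osculating2 {n : ℕ} (p : Fin 2 → Fin (n + 1) → ℤ) : Prop :=
  (∀ k, IsSteps (p k)) ∧ (∀ m, p 0 m ≤ p 1 m) ∧
    ∀ m : Fin n, p 0 m.castSucc = p 1 m.castSucc → p 0 m.succ < p 1 m.succ

/-- A vicious (non-intersecting) configuration of two walkers. -/
def Vicious2 {n : ℕ} (p : Fin 2 → Fin (n + 1) → ℤ) : Prop :=
  (∀ k, IsSteps (p k)) ∧ ∀ m, p 0 m < p 1 m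

/-- An `i`-star of two walkers starts at ordinates `0` and `2i`. -/
def Starts2 {n : ℕ} (i : ℕ) (p : Fin 2 → Fin (n + 1) → ℤ) : Prop :=
  p 0 0 = 0 ∧ p 1 0 = 2 * (i : ℤ)

/-- The number of osculations of a two-walker configuration: indices `m < n` at which
the two walkers occupy the same site. -/
noncomputable def oscNum2 {n : ℕ} (p : Fin 2 → Fin (n + 1) → ℤ) : ℕ :=
  Nat.card {m : Fin n // p 0 m.castSucc = p 1 m.castSucc}

/-- The number of osculating `i`-stars of two walkers of length `n` with exactly `s`
osculations and final distance `j_{n,2} - j_{n,1} = 2k`. -/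
noncomputable def aOsc (i n s k : ℕ) : ℕ :=
  Nat.card {p : Fin 2 → Fin (n + 1) → ℤ // Osculating2 p ∧ Starts2 i p ∧ oscNum2 p = s ∧
    p 1 (Fin.last n) - p 0 (Fin.last n) = 2 * (k : ℤ)}

/-- The number of vicious `i`-stars of two walkers of length `n` with final distance
`j_{n,2} - j_{n,1} = 2k`. -/
noncomputable def cVic (i n k : ℕ) : ℕ :=
  Nat.card {p : Fin 2 → Fin (n + 1) → ℤ // Vicious2 p ∧ Starts2 i p ∧
    p 1 (Fin.last n) - p 0 (Fin.last n) = 2 * (k : ℤ)}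

/-- The complete generating function `O_i(t;u,x)` of osculating `i`-stars, as a
multivariate power series in `t = X 0`, `u = X 1`, `x = X 2`. -/
noncomputable def Ocgf2 (i : ℕ) : MvPowerSeries (Fin 3) ℚ :=
  fun e => (aOsc i (e 0) (e 1) (e 2) : ℚ)

/-- The complete generating function `V_i(t;x)` of vicious `i`-stars, viewed as a
multivariate power series in `t = X 0`, `u = X 1`, `x = X 2` (not involving `u`). -/
noncomputable def Vcgf2 (i : ℕ) : MvPowerSeries (Fin 3) ℚ :=
  fun e => if e 1 = 0 then (cVic i (e 0) (e 2) : ℚ) else 0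

/-- The specialization `O_i(t;1,x)`, as a multivariate power series in `t = X 0`,
`x = X 1` (there are at most `n` osculations at length `n`). -/
noncomputable def Ocgf2u1 (i : ℕ) : MvPowerSeries (Fin 2) ℚ :=
  fun e => ∑ s ∈ Finset.range (e 0 + 1), (aOsc i (e 0) s (e 1) : ℚ)

/-- The complete generating function `V_i(t;x)` of vicious `i`-stars, as a multivariate
power series in `t = X 0`, `x = X 1`. -/
noncomputable def Vcgf2' (i : ℕ) : MvPowerSeries (Fin 2) ℚ :=
  fun e => (cVic i (e 0) (e 1) : ℚ)

theorem eq_zero_of_firstStep_recurrence {R : Type*} [CommRing R] {t u : R} {D : ℕ → R}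
    (ht : ∀ r : R, (∀ n : ℕ, t ^ n ∣ r) → r = 0) (h0 : D 0 = u * t * D 1)
    (hs : ∀ i, D (i + 1) = t * (D (i + 2) + 2 * D (i + 1) + D i)) (i : ℕ) : D i = 0 := by
  refine ht _ fun n => ?_
  induction n generalizing i with
  | zero => simp
  | succ n ih =>
    cases i with
    | zero =>
      rw [h0, pow_succ', mul_comm u t, mul_assoc]
      exact mul_dvd_mul_left t ((ih 1).mul_left u)
    | succ i =>
      rw [hs, pow_succ']
      exact mul_dvd_mul_left t (((ih _).add ((ih _).mul_left 2)).add (ih _))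

/-- The osculating-vicious relation, from the first-step recurrences of the two families. -/
theorem osculating_vicious_relation_of_recurrences {R : Type*} [CommRing R] {t u x : R}
    {O V : ℕ → R} (ht : ∀ r : R, (∀ n : ℕ, t ^ n ∣ r) → r = 0)
    (hO0 : O 0 = 1 + u * t * O 1)
    (hO : ∀ i, O (i + 1) = x ^ (i + 1) + t * (O (i + 2) + 2 * O (i + 1) + O i))
    (hV0 : V 0 = 0)
    (hV : ∀ i, V (i + 1) = x ^ (i + 1) + t * (V (i + 2) + 2 * V (i + 1) + V i)) (i : ℕ) :
    ((1 + u * t) ^ 2 - u) * x * O i =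
      x ^ (i + 1) * (1 - u + 2 * t * u + x * t * u * (1 - u)) +
        t * (1 + 2 * x + x ^ 2 * (1 - u)) *
          ((1 - u + 2 * t * u) * V i + t * u * V (i + 1)) := by
  rw [← sub_eq_zero]
  refine eq_zero_of_firstStep_recurrence (u := u) (D := fun i =>
    ((1 + u * t) ^ 2 - u) * x * O i -
      (x ^ (i + 1) * (1 - u + 2 * t * u + x * t * u * (1 - u)) +
        t * (1 + 2 * x + x ^ 2 * (1 - u)) *
          ((1 - u + 2 * t * u) * V i + t * u * V (i + 1)))) ht ?_ (fun i => ?_) i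
  · have h := hV 0
    simp only [zero_add, hV0] at h ⊢
    linear_combination ((1 + u * t) ^ 2 - u) * x * hO0 -
      u ^ 2 * t ^ 2 * (1 + 2 * x + x ^ 2 * (1 - u)) * h
  · linear_combination ((1 + u * t) ^ 2 - u) * x * hO i -
      t * (1 + 2 * x + x ^ 2 * (1 - u)) * (1 - u + 2 * t * u) * hV i -
      t * (1 + 2 * x + x ^ 2 * (1 - u)) * (t * u) * hV (i + 1)

theorem MvPowerSeries.eq_zero_of_X_pow_dvd {σ R : Type*} [CommRing R] (s : σ)
    (r : MvPowerSeries σ R) (h : ∀ n : ℕ, (X s : MvPowerSeries σ R) ^ n ∣ r) : r = 0 := by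
  ext e
  exact X_pow_dvd_iff.1 (h (e s + 1)) e (Nat.lt_succ_self _)

/-- The number of pairs of `±1`-step walks of length `n` that start at ordinates `0` and `d`
and satisfy `Q`. -/
noncomputable def starCount {n : ℕ} (Q : (Fin 2 → Fin (n + 1) → ℤ) → Prop) (d : ℤ) : ℕ :=
  Nat.card {p : Fin 2 → Fin (n + 1) → ℤ // (∀ k, IsSteps (p k)) ∧ p 0 0 = 0 ∧ p 1 0 = d ∧ Q p}

theorem IsSteps.abs_sub_zero_le {n : ℕ} {w : Fin (n + 1) → ℤ} (hw : IsSteps w)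
    (m : Fin (n + 1)) : |w m - w 0| ≤ m := by
  induction m using Fin.induction with
  | zero => simp
  | succ m ih =>
    rw [abs_le] at ih ⊢
    have := hw m
    simp only [Fin.val_castSucc, Fin.val_succ, Nat.cast_add, Nat.cast_one] at ih ⊢
    lia

instance finite_stars {n : ℕ} (Q : (Fin 2 → Fin (n + 1) → ℤ) → Prop) (d : ℤ) :
    Finite {p : Fin 2 → Fin (n + 1) → ℤ //
      (∀ k, IsSteps (p k)) ∧ p 0 0 = 0 ∧ p 1 0 = d ∧ Q p} := by
  refine Set.Finite.subset (Set.finite_Icc (fun _ _ => -|d| - n) (fun _ _ => |d| + n)) ?_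
  rintro p ⟨hs, h0, h1, -⟩
  have key : ∀ k m, -|d| - n ≤ p k m ∧ p k m ≤ |d| + n := by
    intro k m
    have hm := abs_le.1 ((hs k).abs_sub_zero_le m)
    have hn : ((m : ℕ) : ℤ) ≤ n := by exact_mod_cast Nat.lt_succ_iff.1 m.2
    have hd := abs_le.1 (le_refl |d|)
    have hd0 := abs_nonneg d
    fin_cases k <;> simp only [Fin.zero_eta, Fin.mk_one] at hm ⊢ <;> lia
  exact ⟨fun k m => (key k m).1, fun k m => (key k m).2⟩

theorem starCount_congr {n : ℕ} {Q Q' : (Fin 2 → Fin (n + 1) → ℤ) → Prop} {d : ℤ}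
    (h : ∀ p, p 0 0 = 0 → p 1 0 = d → (Q p ↔ Q' p)) : starCount Q d = starCount Q' d :=
  Nat.card_congr <| Equiv.subtypeEquivRight fun p =>
    and_congr_right fun _ => and_congr_right fun h0 => and_congr_right fun h1 => h p h0 h1

theorem starCount_eq_zero {n : ℕ} {Q : (Fin 2 → Fin (n + 1) → ℤ) → Prop} {d : ℤ}
    (h : ∀ p, p 0 0 = 0 → p 1 0 = d → ¬ Q p) : starCount Q d = 0 :=
  Nat.card_eq_zero.2 (.inl ⟨fun p => h p.1 p.2.2.1 p.2.2.2.1 p.2.2.2.2⟩)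

theorem isSteps_succ_iff {n : ℕ} {w : Fin (n + 2) → ℤ} :
    IsSteps w ↔ (w 1 - w 0 = 1 ∨ w 1 - w 0 = -1) ∧ IsSteps (Fin.tail w) := by
  simp only [IsSteps, Fin.forall_fin_succ (n := n), Fin.tail, Fin.succ_castSucc]
  rfl

theorem isSteps_add_const {n : ℕ} {w : Fin (n + 1) → ℤ} (c : ℤ) :
    IsSteps (fun m => w m + c) ↔ IsSteps w := by
  simp [IsSteps]

/-- The step `+1` or `-1` encoded by a Boolean. -/
def boolStep (b : Bool) : ℤ := if b then 1 else -1

/-- Removing the first step of a pair of walks, and translating the rest so that the lower walk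
starts at `0`. -/
noncomputable def firstStepEquiv {n : ℕ} (Q : (Fin 2 → Fin (n + 1) → ℤ) → Prop)
    (hQ : ∀ q c, Q (fun k m => q k m + c) ↔ Q q) (d : ℤ) :
    {p : Fin 2 → Fin (n + 2) → ℤ // (∀ k, IsSteps (p k)) ∧ p 0 0 = 0 ∧ p 1 0 = d ∧
        Q (fun k => Fin.tail (p k))} ≃
      Σ e : Bool × Bool, {q : Fin 2 → Fin (n + 1) → ℤ // (∀ k, IsSteps (q k)) ∧ q 0 0 = 0 ∧
        q 1 0 = d + (boolStep e.2 - boolStep e.1) ∧ Q q} where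
  toFun p := ⟨(decide (p.1 0 1 = 1), decide (p.1 1 1 = d + 1)),
    fun k m => Fin.tail (p.1 k) m + -p.1 0 1, by
      obtain ⟨p, hs, h0, h1, hq⟩ := p
      simp only [isSteps_succ_iff, isSteps_add_const, hQ] at hs ⊢
      have hs0 := (hs 0).1
      have hs1 := (hs 1).1
      refine ⟨fun k => (hs k).2, ?_, ?_, hq⟩
      · simp [Fin.tail]
      · simp only [Fin.tail, Fin.succ_zero_eq_one, boolStep, decide_eq_true_eq]
        split_ifs <;> lia⟩
  invFun q := ⟨fun k => Fin.cons (if k = 0 then 0 else d)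
      (fun m => q.2.1 k m + boolStep q.1.1), by
    obtain ⟨e, q, hs, h0, h1, hq⟩ := q
    simp only [isSteps_succ_iff, Fin.tail_cons, isSteps_add_const, hQ]
    refine ⟨fun k => ⟨?_, hs k⟩, by simp, by simp, hq⟩
    rw [← Fin.succ_zero_eq_one, Fin.cons_succ, Fin.cons_zero]
    simp only [boolStep] at h1 ⊢
    fin_cases k <;> simp only [Fin.zero_eta, Fin.mk_one, if_true, one_ne_zero, if_false] <;>
      split_ifs at h1 ⊢ <;> lia⟩
  left_inv := by
    rintro ⟨p, hs, h0, h1, hq⟩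
    have hs0 := (isSteps_succ_iff.1 (hs 0)).1
    ext k m
    refine Fin.cases ?_ (fun m => ?_) m
    · fin_cases k <;> simp [h0, h1]
    · simp only [Fin.cons_succ, Fin.tail, boolStep, decide_eq_true_eq]
      split_ifs <;> lia
  right_inv := by
    rintro ⟨⟨a, b⟩, q, hs, h0, h1, hq⟩
    have hc (x : ℤ) (f : Fin (n + 1) → ℤ) : (Fin.cons x f : Fin (n + 2) → ℤ) 1 = f 0 := rfl
    refine Sigma.subtype_ext (Prod.ext ?_ ?_) ?_
    · cases a <;> simp [hc, h0, boolStep]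
    · cases a <;> cases b <;> (simp [hc, h1, boolStep]; try lia)
    · funext k m
      simp [hc, h0]

theorem starCount_tail {n : ℕ} {Q : (Fin 2 → Fin (n + 1) → ℤ) → Prop}
    (hQ : ∀ q c, Q (fun k m => q k m + c) ↔ Q q) (d : ℤ) :
    starCount (n := n + 1) (fun p => Q (fun k => Fin.tail (p k))) d =
      starCount Q (d + 2) + 2 * starCount Q d + starCount Q (d - 2) := by
  rw [starCount, Nat.card_congr (firstStepEquiv Q hQ d), Nat.card_sigma]
  simp only [Fintype.sum_prod_type, Fintype.sum_bool, boolStep, starCount, if_true, Bool.false_eq_true, if_false]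
  rw [show d + (1 - 1) = d by ring, show d + (-1 - -1) = d by ring,
    show d + (1 - -1) = d + 2 by ring, show d + (-1 - 1) = d - 2 by ring]
  ring

/-- The conditions, apart from the steps and the starting points, on the stars that `cVic`
counts. -/
def VicTail (n k : ℕ) (p : Fin 2 → Fin (n + 1) → ℤ) : Prop :=
  (∀ m, p 0 m < p 1 m) ∧ p 1 (Fin.last n) - p 0 (Fin.last n) = 2 * (k : ℤ)

/-- The conditions, apart from the steps and the starting points, on the stars that `aOsc`
counts. -/
def OscTail (n s k : ℕ) (p : Fin 2 → Fin (n + 1) → ℤ) : Prop :=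
  (∀ m, p 0 m ≤ p 1 m) ∧
    (∀ m : Fin n, p 0 m.castSucc = p 1 m.castSucc → p 0 m.succ < p 1 m.succ) ∧
    oscNum2 p = s ∧ p 1 (Fin.last n) - p 0 (Fin.last n) = 2 * (k : ℤ)

theorem vicTail_add_const {n k : ℕ} (q : Fin 2 → Fin (n + 1) → ℤ) (c : ℤ) :
    VicTail n k (fun j m => q j m + c) ↔ VicTail n k q := by
  simp [VicTail]

theorem oscTail_add_const {n s k : ℕ} (q : Fin 2 → Fin (n + 1) → ℤ) (c : ℤ) :
    OscTail n s k (fun j m => q j m + c) ↔ OscTail n s k q := by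
  simp [OscTail, oscNum2]

theorem cVic_eq_starCount (i n k : ℕ) : cVic i n k = starCount (VicTail n k) (2 * i) :=
  Nat.card_congr <| Equiv.subtypeEquivRight fun p => by
    simp only [Vicious2, Starts2, VicTail]; tauto

theorem aOsc_eq_starCount (i n s k : ℕ) : aOsc i n s k = starCount (OscTail n s k) (2 * i) :=
  Nat.card_congr <| Equiv.subtypeEquivRight fun p => by
    simp only [Osculating2, Starts2, OscTail]; tauto

theorem oscNum2_succ {n : ℕ} (p : Fin 2 → Fin (n + 2) → ℤ) :
    oscNum2 p = (if p 0 0 = p 1 0 then 1 else 0) + oscNum2 (fun j => Fin.tail (p j)) := by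
  simp only [oscNum2, Nat.card_eq_fintype_card, Fintype.card_subtype, Finset.card_filter,
    Fin.sum_univ_succ (n := n)]
  rfl

theorem oscNum2_le {n : ℕ} (p : Fin 2 → Fin (n + 1) → ℤ) : oscNum2 p ≤ n := by
  rw [oscNum2, Nat.card_eq_fintype_card]
  exact (Fintype.card_subtype_le _).trans_eq (Fintype.card_fin n)

theorem vicTail_succ {n k : ℕ} {p : Fin 2 → Fin (n + 2) → ℤ} (h : p 0 0 < p 1 0) :
    VicTail (n + 1) k p ↔ VicTail n k (fun j => Fin.tail (p j)) := by
  simp [VicTail, Fin.forall_fin_succ (n := n + 1), h, Fin.tail]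

theorem oscTail_succ_of_lt {n s k : ℕ} {p : Fin 2 → Fin (n + 2) → ℤ} (h : p 0 0 < p 1 0) :
    OscTail (n + 1) s k p ↔ OscTail n s k (fun j => Fin.tail (p j)) := by
  simp [OscTail, oscNum2_succ, Fin.forall_fin_succ (n := n + 1), Fin.forall_fin_succ (n := n), h.le,
    h.ne, Fin.tail]

theorem oscTail_succ_of_eq {n s k : ℕ} {p : Fin 2 → Fin (n + 2) → ℤ} (h : p 0 0 = p 1 0) :
    OscTail (n + 1) (s + 1) k p ↔
      Fin.tail (p 0) 0 < Fin.tail (p 1) 0 ∧ OscTail n s k (fun j => Fin.tail (p j)) := by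
  simp [OscTail, oscNum2_succ, Fin.forall_fin_succ (n := n + 1), Fin.forall_fin_succ (n := n), h,
    Fin.tail, add_comm 1]
  tauto

theorem cVic_zero_left (n k : ℕ) : cVic 0 n k = 0 := by
  rw [cVic_eq_starCount]
  exact starCount_eq_zero fun p h0 h1 h => by have := h.1 0; simp_all

theorem cVic_succ_succ (i n k : ℕ) :
    cVic (i + 1) (n + 1) k = cVic (i + 2) n k + 2 * cVic (i + 1) n k + cVic i n k := by
  simp only [cVic_eq_starCount]
  rw [starCount_congr fun p h0 h1 => vicTail_succ (by rw [h0, h1]; positivity),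
    starCount_tail vicTail_add_const]
  congr 3
  all_goals push_cast; ring

theorem aOsc_succ_succ (i n s k : ℕ) :
    aOsc (i + 1) (n + 1) s k =
      aOsc (i + 2) n s k + 2 * aOsc (i + 1) n s k + aOsc i n s k := by
  simp only [aOsc_eq_starCount]
  rw [starCount_congr fun p h0 h1 => oscTail_succ_of_lt (by rw [h0, h1]; positivity),
    starCount_tail oscTail_add_const]
  congr 3
  all_goals push_cast; ring

theorem aOsc_zero_succ_succ (n s k : ℕ) : aOsc 0 (n + 1) (s + 1) k = aOsc 1 n s k := by
  simp only [aOsc_eq_starCount]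
  rw [starCount_congr fun p h0 h1 => oscTail_succ_of_eq (by rw [h0, h1]; simp),
    starCount_tail (Q := fun q => q 0 0 < q 1 0 ∧ OscTail n s k q)
      (fun q c => by rw [oscTail_add_const]; simp),
    starCount_congr (d := 2 * ((0 : ℕ) : ℤ) + 2) (Q' := OscTail n s k),
    starCount_eq_zero (d := 2 * ((0 : ℕ) : ℤ)), starCount_eq_zero (d := 2 * ((0 : ℕ) : ℤ) - 2)]
  · simp
  all_goals
    intro p h0 h1
    rw [h0, h1]
    simp

theorem aOsc_zero_succ_zero (n k : ℕ) : aOsc 0 (n + 1) 0 k = 0 := by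
  rw [aOsc_eq_starCount]
  refine starCount_eq_zero fun p h0 h1 h => ?_
  have := h.2.2.1
  rw [oscNum2_succ, h0, h1] at this
  simp at this

theorem aOsc_eq_zero_of_lt {i n s k : ℕ} (h : n < s) : aOsc i n s k = 0 := by
  rw [aOsc_eq_starCount]
  exact starCount_eq_zero fun p _ _ hp => ((oscNum2_le p).trans_lt h).ne hp.2.2.1

theorem starCount_length_zero {Q : (Fin 2 → Fin 1 → ℤ) → Prop} {d : ℤ}
    (h : ∀ p, p 0 0 = 0 → p 1 0 = d → Q p) : starCount Q d = 1 := by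
  refine Nat.card_eq_one_iff_unique.2 ⟨⟨fun p q => ?_⟩, ⟨![fun _ => 0, fun _ => d], ?_⟩⟩
  · ext k m
    obtain rfl := Subsingleton.elim (α := Fin 1) m 0
    have := p.2.2; have := q.2.2
    fin_cases k <;> simp_all
  · exact ⟨fun k m => m.elim0, rfl, rfl, h _ rfl rfl⟩

theorem cVic_length_zero (i k : ℕ) : cVic (i + 1) 0 k = if k = i + 1 then 1 else 0 := by
  rw [cVic_eq_starCount]
  split_ifs with h
  · refine starCount_length_zero fun p h0 h1 => ⟨fun m => ?_, ?_⟩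
    · rw [Subsingleton.elim (α := Fin 1) m 0, h0, h1]; positivity
    · rw [show Fin.last 0 = 0 from rfl, h0, h1, h, sub_zero]
  · refine starCount_eq_zero fun p h0 h1 hp => h ?_
    have := hp.2
    rw [show Fin.last 0 = 0 from rfl, h0, h1] at this
    lia

theorem aOsc_length_zero (i s k : ℕ) : aOsc i 0 s k = if s = 0 ∧ k = i then 1 else 0 := by
  rw [aOsc_eq_starCount]
  split_ifs with h
  · refine starCount_length_zero fun p h0 h1 => ⟨fun m => ?_, fun m => m.elim0, ?_, ?_⟩
    · rw [Subsingleton.elim (α := Fin 1) m 0, h0, h1]; positivity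
    · exact (Nat.le_zero.1 (oscNum2_le p)).trans h.1.symm
    · rw [show Fin.last 0 = 0 from rfl, h0, h1, h.2, sub_zero]
  · refine starCount_eq_zero fun p h0 h1 hp => h ⟨?_, ?_⟩
    · exact hp.2.2.1.symm.trans (Nat.le_zero.1 (oscNum2_le p))
    · have := hp.2.2.2
      rw [show Fin.last 0 = 0 from rfl, h0, h1] at this
      lia

section GeneratingFunctions

open MvPowerSeries

theorem MvPowerSeries.coeff_X_mul_eq_ite {σ R : Type*} [CommSemiring R] (s : σ)
    (φ : MvPowerSeries σ R) (e : σ →₀ ℕ) :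
    coeff e (X s * φ) = if e s = 0 then 0 else coeff (e - Finsupp.single s 1) φ := by
  classical
  rw [X_def, coeff_monomial_mul]
  simp only [Finsupp.single_le_iff, one_mul]
  split_ifs <;> lia

theorem coeff_Ocgf2 (i : ℕ) (e : Fin 3 →₀ ℕ) :
    coeff e (Ocgf2 i) = (aOsc i (e 0) (e 1) (e 2) : ℚ) := rfl

theorem coeff_Vcgf2 (i : ℕ) (e : Fin 3 →₀ ℕ) :
    coeff e (Vcgf2 i) = if e 1 = 0 then (cVic i (e 0) (e 2) : ℚ) else 0 := rfl

theorem coeff_Ocgf2u1 (i : ℕ) (e : Fin 2 →₀ ℕ) :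
    coeff e (Ocgf2u1 i) = ∑ s ∈ Finset.range (e 0 + 1), (aOsc i (e 0) s (e 1) : ℚ) := rfl

theorem coeff_Vcgf2' (i : ℕ) (e : Fin 2 →₀ ℕ) :
    coeff e (Vcgf2' i) = (cVic i (e 0) (e 1) : ℚ) := rfl

theorem eq_single_two_iff {e : Fin 3 →₀ ℕ} {i : ℕ} :
    e = Finsupp.single 2 i ↔ e 0 = 0 ∧ e 1 = 0 ∧ e 2 = i := by
  simp [Finsupp.ext_iff, Fin.forall_fin_succ, Finsupp.single_apply]

theorem eq_single_one_iff {e : Fin 2 →₀ ℕ} {i : ℕ} :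
    e = Finsupp.single 1 i ↔ e 0 = 0 ∧ e 1 = i := by
  simp [Finsupp.ext_iff, Fin.forall_fin_succ, Finsupp.single_apply]

theorem Ocgf2_succ (i : ℕ) :
    Ocgf2 (i + 1) = X 2 ^ (i + 1) + X 0 * (Ocgf2 (i + 2) + 2 * Ocgf2 (i + 1) + Ocgf2 i) := by
  ext e
  simp only [two_mul, map_add, coeff_X_mul_eq_ite, coeff_X_pow, coeff_Ocgf2, eq_single_two_iff,
    Finsupp.tsub_apply]
  rcases h : e 0 with _ | n
  · simp [aOsc_length_zero]
  · simp [aOsc_succ_succ, two_mul]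

theorem Ocgf2_zero : Ocgf2 0 = 1 + X 1 * X 0 * Ocgf2 1 := by
  ext e
  have h1 : (1 : MvPowerSeries (Fin 3) ℚ) = X 2 ^ 0 := (pow_zero _).symm
  have h10 : (Finsupp.single 1 1 : Fin 3 →₀ ℕ) 0 = 0 := by simp
  simp only [h1, map_add, mul_assoc, coeff_X_mul_eq_ite, coeff_X_pow, coeff_Ocgf2,
    eq_single_two_iff, Finsupp.tsub_apply, h10, tsub_zero]
  rcases h : e 0 with _ | n
  · simp [aOsc_length_zero]
  · rcases h' : e 1 with _ | s
    · simp [aOsc_zero_succ_zero]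
    · simp [aOsc_zero_succ_succ]

theorem Vcgf2_succ (i : ℕ) :
    Vcgf2 (i + 1) = X 2 ^ (i + 1) + X 0 * (Vcgf2 (i + 2) + 2 * Vcgf2 (i + 1) + Vcgf2 i) := by
  ext e
  simp only [two_mul, map_add, coeff_X_mul_eq_ite, coeff_X_pow, coeff_Vcgf2, eq_single_two_iff,
    Finsupp.tsub_apply]
  rcases h : e 0 with _ | n <;> by_cases h' : e 1 = 0
  · simp [cVic_length_zero, h']
  · simp [h']
  · simp [cVic_succ_succ, two_mul, h']
  · simp [h']

theorem Vcgf2_zero : Vcgf2 0 = 0 := by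
  ext e
  simp [coeff_Vcgf2, cVic_zero_left]

theorem Ocgf2u1_succ (i : ℕ) :
    Ocgf2u1 (i + 1) =
      X 1 ^ (i + 1) + X 0 * (Ocgf2u1 (i + 2) + 2 * Ocgf2u1 (i + 1) + Ocgf2u1 i) := by
  ext e
  simp only [two_mul, map_add, coeff_X_mul_eq_ite, coeff_X_pow, coeff_Ocgf2u1, eq_single_one_iff,
    Finsupp.tsub_apply]
  rcases h : e 0 with _ | n
  · simp only [zero_add, Finset.sum_range_one, aOsc_length_zero]
    simp
  · simp [aOsc_succ_succ, two_mul, Finset.sum_add_distrib, Finset.sum_range_succ _ (n + 1),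
      aOsc_eq_zero_of_lt (Nat.lt_succ_self n)]

theorem Ocgf2u1_zero : Ocgf2u1 0 = 1 + X 0 * Ocgf2u1 1 := by
  ext e
  have h1 : (1 : MvPowerSeries (Fin 2) ℚ) = X 1 ^ 0 := (pow_zero _).symm
  simp only [h1, map_add, coeff_X_mul_eq_ite, coeff_X_pow, coeff_Ocgf2u1, eq_single_one_iff,
    Finsupp.tsub_apply]
  rcases h : e 0 with _ | n
  · simp only [zero_add, Finset.sum_range_one, aOsc_length_zero]
    simp
  · simp [aOsc_zero_succ_succ, aOsc_zero_succ_zero, Finset.sum_range_succ' _ (n + 1)]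

theorem Vcgf2'_succ (i : ℕ) :
    Vcgf2' (i + 1) =
      X 1 ^ (i + 1) + X 0 * (Vcgf2' (i + 2) + 2 * Vcgf2' (i + 1) + Vcgf2' i) := by
  ext e
  simp only [two_mul, map_add, coeff_X_mul_eq_ite, coeff_X_pow, coeff_Vcgf2', eq_single_one_iff,
    Finsupp.tsub_apply]
  rcases h : e 0 with _ | n
  · simp [cVic_length_zero]
  · simp [cVic_succ_succ, two_mul]

theorem Vcgf2'_zero : Vcgf2' 0 = 0 := by
  ext e
  simp [coeff_Vcgf2', cVic_zero_left]

end GeneratingFunctions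

open MvPowerSeries in
theorem two_walker_osculating_vicious_relation (i : ℕ) (hi : 1 ≤ i) :
    (((1 + (X 1 : MvPowerSeries (Fin 3) ℚ) * X 0) ^ 2 - X 1) * X 2 * Ocgf2 i =
      X 2 ^ (i + 1) * (1 - X 1 + 2 * X 0 * X 1 + X 2 * X 0 * X 1 * (1 - X 1)) +
        X 0 * (1 + 2 * X 2 + X 2 ^ 2 * (1 - X 1)) *
          ((1 - X 1 + 2 * X 0 * X 1) * Vcgf2 i + X 0 * X 1 * Vcgf2 (i + 1)))
    ∧
    ((2 + (X 0 : MvPowerSeries (Fin 2) ℚ)) * X 1 * Ocgf2u1 i =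
      2 * X 1 ^ (i + 1) + X 0 * (1 + 2 * X 1) * (2 * Vcgf2' i + Vcgf2' (i + 1))) := by
  refine ⟨osculating_vicious_relation_of_recurrences (eq_zero_of_X_pow_dvd 0) Ocgf2_zero
    Ocgf2_succ Vcgf2_zero Vcgf2_succ i, ?_⟩
  have h := osculating_vicious_relation_of_recurrences (u := 1)
    (eq_zero_of_X_pow_dvd (0 : Fin 2)) (by rw [one_mul]; exact Ocgf2u1_zero) Ocgf2u1_succ
    Vcgf2'_zero Vcgf2'_succ i
  have hX : (X 0 : MvPowerSeries (Fin 2) ℚ) ≠ 0 := fun h0 => by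
    simpa using congrArg (coeff (Finsupp.single 0 1)) h0
  refine mul_left_cancel₀ hX ?_
  linear_combination h
end
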